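/- Let p ≥ 2 and let n be a Nevanlinna function satisfying condition (1_p) with coefficients s₀,…,s_{2p}, and assume D_p > 0. Let ŝ₀,…,ŝ_{2p−2} be the coefficients in the expansion of the Schur transform n̂(z) = −s₀/n(z) − z + s₁/s₀ (which satisfies condition (1_{p−1}) and has positive Hankel determinants D̂₀,…,D̂_{p−1}). Then the polynomials of the second kind d̂_k associated with (ŝ_j) satisfy, for k = 0,…,p−1: d̂_k(z) = −√s₀·e_{k+1}(z) + (1/√s₀)·(z − s₁/s₀)·d_{k+1}(z), where e_{k+1}, d_{k+1} are the polynomials of the first and second kind associated with (s_j). -/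

import Mathlib

open Filter Complex Polynomial

noncomputable section

/-- A Nevanlinna function: analytic on `ℂ ∖ ℝ`, symmetric with respect to conjugation,
and with non-negative imaginary part in the upper half plane. -/
def IsNevanlinna (n : ℂ → ℂ) : Prop :=
  AnalyticOn ℂ n {z : ℂ | z.im ≠ 0} ∧
  (∀ z : ℂ, z.im ≠ 0 → n ((starRingEnd ℂ) z) = (starRingEnd ℂ) (n z)) ∧
  (∀ z : ℂ, 0 < z.im → 0 ≤ (n z).im)

/-- Condition `(1_q)` with coefficients `s 0, …, s (2q)`:
`n(iy) = -s₀/(iy) - s₁/(iy)² - ⋯ - s_{2q}/(iy)^{2q+1} + o(|y|^{-(2q+1)})` as `y → ±∞`. -/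
def Cond1 (n : ℂ → ℂ) (q : ℕ) (s : ℕ → ℝ) : Prop :=
  Tendsto
    (fun y : ℝ => (Complex.I * y) ^ (2 * q + 1) *
      (n (Complex.I * y) +
        ∑ j ∈ Finset.range (2 * q + 1), (s j : ℂ) / (Complex.I * y) ^ (j + 1)))
    (atTop ⊔ atBot) (nhds 0)

/-- The Hankel determinant `D_k = det (s_{i+j})_{i,j=0}^{k}`. -/
def hankelDet (s : ℕ → ℝ) (k : ℕ) : ℝ :=
  (Matrix.of fun i j : Fin (k + 1) => s ((i : ℕ) + (j : ℕ))).det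

/-- The orthonormal polynomials of the first kind: `e₀(z) = 1/√s₀`, and for `k ≥ 1`,
`e_k(z) = (D_{k-1}D_k)^{-1/2}` times the determinant of the `(k+1)×(k+1)` matrix whose
`i`-th row (`i = 0,…,k-1`) is `(s_i, …, s_{i+k})` and whose last row is `(1, z, …, z^k)`. -/
def ePoly (s : ℕ → ℝ) : ℕ → Polynomial ℝ
  | 0 => Polynomial.C (1 / Real.sqrt (s 0))
  | (k + 1) =>
      Polynomial.C (1 / Real.sqrt (hankelDet s k * hankelDet s (k + 1))) *
        (Matrix.of fun i j : Fin (k + 2) =>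
          if (i : ℕ) < k + 1 then Polynomial.C (s ((i : ℕ) + (j : ℕ)))
          else Polynomial.X ^ (j : ℕ)).det

/-- The polynomials of the second kind: `d_k(z) = L_t((e_k(z) - e_k(t))/(z - t))`, where
`L` is the linear functional with `L(t^j) = s_j`; concretely, if `e_k = Σ_m a_m X^m`, then
`d_k = Σ_m a_m Σ_{r<m} s_r X^{m-1-r}`. -/
def dPoly (s : ℕ → ℝ) (k : ℕ) : Polynomial ℝ :=
  ∑ m ∈ Finset.range ((ePoly s k).natDegree + 1),
    Polynomial.C ((ePoly s k).coeff m) *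
      ∑ r ∈ Finset.range m, Polynomial.C (s r) * Polynomial.X ^ (m - 1 - r)


/-- Coefficients of the series `1 - a w - w² Ŝ(w)`. -/
def schurR (a : ℝ) (sh : ℕ → ℝ) : ℕ → ℝ
  | 0 => 1
  | 1 => -a
  | (j + 2) => -sh j

/-- The lower triangular Toeplitz kernel. -/
def toep {A : Type*} [CommRing A] (R : ℕ → A) (i j : ℕ) : A := if j ≤ i then R (i - j) else 0

theorem toep_sum {A : Type*} [CommRing A] (R f : ℕ → A) (N j : ℕ) (hj : j < N) :
    ∑ b : Fin N, toep R j b * f b = ∑ b ∈ Finset.range (j + 1), R (j - b) * f b := by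
  rw [Fin.sum_univ_eq_sum_range (fun b => toep R j b * f b) N]
  rw [← Finset.sum_subset (Finset.range_subset_range.2 (by omega : j + 1 ≤ N))]
  · apply Finset.sum_congr rfl
    intro b hb
    simp only [Finset.mem_range] at hb
    simp [toep, show b ≤ j by omega]
  · intro b _ hb
    simp only [Finset.mem_range] at hb
    simp [toep, show ¬ b ≤ j by omega]

/-- Convolution with `R`. -/
def cnv {A : Type*} [CommRing A] (R f : ℕ → A) (j : ℕ) : A :=
  ∑ b ∈ Finset.range (j + 1), R (j - b) * f b

theorem cnv_succ {A : Type*} [CommRing A] (R f : ℕ → A) (j : ℕ) :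
    cnv R f (j + 1) = R (j + 1) * f 0 + cnv R (fun b => f (b + 1)) j := by
  unfold cnv
  rw [Finset.sum_range_succ', add_comm]
  congr 1
  apply Finset.sum_congr rfl
  intro b _
  congr 2
  omega

theorem cnv_add {A : Type*} [CommRing A] (R f g : ℕ → A) (j : ℕ) :
    cnv R (fun b => f b + g b) j = cnv R f j + cnv R g j := by
  simp [cnv, mul_add, Finset.sum_add_distrib]

theorem cnv_mul {A : Type*} [CommRing A] (R f : ℕ → A) (c : A) (j : ℕ) :
    cnv R (fun b => c * f b) j = c * cnv R f j := by
  simp only [cnv, Finset.mul_sum]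
  apply Finset.sum_congr rfl
  intro b _
  ring

theorem cnv_zero {A : Type*} [CommRing A] (R f : ℕ → A) : cnv R f 0 = R 0 * f 0 := by
  simp [cnv]

/-- The two-sided transform of the Hankel matrix. -/
def hankV (R s : ℕ → ℝ) (i j : ℕ) : ℝ := cnv R (fun a => cnv R (fun b => s (a + b)) j) i

/-- `1 ⊕ Ĥ`. -/
def hankW (sh : ℕ → ℝ) : ℕ → ℕ → ℝ
  | 0, 0 => 1
  | 0, _ + 1 => 0
  | _ + 1, 0 => 0
  | i + 1, j + 1 => sh (i + j)

theorem hankV_rec (R s : ℕ → ℝ) (i j : ℕ) :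
    hankV R s (i + 1) j = hankV R s i (j + 1) - R (j + 1) * cnv R s i
      + R (i + 1) * cnv R s j := by
  unfold hankV
  have h : ∀ a, cnv R (fun b => s (a + b)) (j + 1)
      = R (j + 1) * s a + cnv R (fun b => s (a + 1 + b)) j := by
    intro a
    rw [cnv_succ]
    simp only [add_zero]
    congr 2
    funext b
    congr 1
    omega
  simp only [h]
  rw [cnv_add, cnv_mul, cnv_succ]
  simp only [zero_add]
  ring

theorem hankV_eq (a : ℝ) (s sh : ℕ → ℝ)
    (h0 : ∀ m, cnv (schurR a sh) s m = if m = 0 then s 0 else 0) (i j : ℕ) :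
    hankV (schurR a sh) s i j = s 0 * hankW sh i j := by
  induction i generalizing j with
  | zero =>
    have : hankV (schurR a sh) s 0 j = cnv (schurR a sh) s j := by
      simp [hankV, cnv_zero, schurR]
    rw [this, h0]
    cases j <;> simp [hankW]
  | succ i ih =>
    rw [hankV_rec, ih, h0, h0]
    cases i with
    | zero =>
      cases j with
      | zero => simp [hankW, schurR]
      | succ j => simp [hankW, schurR]; ring
    | succ i =>
      cases j with
      | zero => simp [hankW, schurR]; ring
      | succ j => simp [hankW, schurR]; left; congr 1; omega

/-- The bordered Hankel matrix with last row `v`. -/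
def bordM (s : ℕ → ℝ) (k : ℕ) (v : ℕ → ℝ[X]) : Matrix (Fin (k + 1)) (Fin (k + 1)) ℝ[X] :=
  Matrix.of fun i j : Fin (k + 1) => if (i : ℕ) < k then C (s ((i : ℕ) + (j : ℕ))) else v j

/-- real cofactors of the last row -/
def cofR (s : ℕ → ℝ) (k : ℕ) (j : Fin (k + 1)) : ℝ :=
  (-1) ^ (k + (j : ℕ)) * (Matrix.of fun (i' j' : Fin k) => s ((i' : ℕ) + (j.succAbove j' : ℕ))).det

theorem bordM_det (s : ℕ → ℝ) (k : ℕ) (v : ℕ → ℝ[X]) :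
    (bordM s k v).det = ∑ j : Fin (k + 1), C (cofR s k j) * v j := by
  rw [Matrix.det_succ_row _ (Fin.last k)]
  apply Finset.sum_congr rfl
  intro j _
  have : ((bordM s k v).submatrix (Fin.last k).succAbove j.succAbove)
      = (Matrix.of fun (i' j' : Fin k) => s ((i' : ℕ) + (j.succAbove j' : ℕ))).map C := by
    ext1 i' j'
    simp [bordM]
  rw [this, cofR]
  have h2 := (RingHom.map_det (C : ℝ →+* ℝ[X])
    (Matrix.of fun (i' j' : Fin k) => s ((i' : ℕ) + (j.succAbove j' : ℕ)))).symm
  simp only [RingHom.mapMatrix_apply] at h2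
  rw [h2]
  simp [bordM]
  ring

theorem toepMat_det {A : Type*} [CommRing A] (R : ℕ → A) (hR : R 0 = 1) (N : ℕ) :
    (Matrix.of fun i j : Fin N => toep R i j).det = 1 := by
  rw [Matrix.det_of_isLowerTriangular]
  · simp [toep, hR]
  · intro i j hij
    have hij' : i < j := hij
    simp [toep, hij']

theorem hankel_schur (a : ℝ) (s sh : ℕ → ℝ)
    (h0 : ∀ m, cnv (schurR a sh) s m = if m = 0 then s 0 else 0) (k : ℕ) :
    hankelDet s (k + 1) = s 0 ^ (k + 2) * hankelDet sh k := by
  set R := schurR a sh with hRdef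
  set T := (Matrix.of fun i j : Fin (k + 2) => toep R i j) with hT
  set H := (Matrix.of fun i j : Fin (k + 2) => s ((i : ℕ) + (j : ℕ))) with hH
  have hdT : T.det = 1 := toepMat_det R rfl _
  have key : T * (T * H).transpose = s 0 • (Matrix.of fun i j : Fin (k + 2) => hankW sh i j) := by
    ext i j
    rw [Matrix.mul_apply]
    have : ∀ b : Fin (k + 2), (T * H).transpose b j = cnv R (fun c => s (b + c)) j := by
      intro b
      rw [Matrix.transpose_apply, Matrix.mul_apply]
      rw [show cnv R (fun c => s (b + c)) j = _ from
        (toep_sum R (fun c => s (b + c)) (k + 2) j j.2).symm]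
      simp [hT, hH, add_comm]
    simp only [this]
    have h3 := toep_sum R (fun b => cnv R (fun c => s (b + c)) j) (k + 2) i i.2
    simp only [hT, Matrix.of_apply]
    rw [h3]
    have := hankV_eq a s sh h0 i j
    simpa [hankV, cnv] using this
  have hd := congrArg Matrix.det key
  rw [Matrix.det_mul, Matrix.det_transpose, Matrix.det_mul, hdT, one_mul, one_mul,
    Matrix.det_smul, Matrix.det_succ_row_zero (Matrix.of fun i j : Fin (k + 2) => hankW sh i j),
    Fin.sum_univ_succ] at hd
  simp only [hankelDet]
  rw [← hH, hd]
  simp [hankW]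
  left
  congr 1

theorem bord_schur (a : ℝ) (s sh : ℕ → ℝ)
    (h0 : ∀ m, cnv (schurR a sh) s m = if m = 0 then s 0 else 0) (k : ℕ)
    (v q : ℕ → ℝ[X])
    (hv : ∀ j, cnv (fun i => C (schurR a sh i)) v (j + 1) = C (s 0) * q j) :
    (bordM s (k + 1) v).det = C (s 0 ^ (k + 2)) * (bordM sh k q).det := by
  set R := schurR a sh with hRdef
  set T := (Matrix.of fun i j : Fin (k + 2) => toep (fun i => C (R i)) i j) with hT
  set T' : Matrix (Fin (k + 2)) (Fin (k + 2)) ℝ[X] := (Matrix.of fun i j : Fin (k + 2) =>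
    if (i : ℕ) < k + 1 then toep (fun i => C (R i)) i j else if j = i then 1 else 0) with hT'
  have hdT : T.det = 1 := toepMat_det _ (by simp [hRdef, schurR]) _
  have hdT' : T'.det = 1 := by
    rw [Matrix.det_of_isLowerTriangular]
    · apply Finset.prod_eq_one
      intro i _
      simp [hT', toep, hRdef, schurR]
    · intro i j hij
      have hij' : i < j := hij
      simp [hT', toep, hij', hij'.ne']
  have hMT : ∀ b j : Fin (k + 2), (bordM s (k + 1) v * T.transpose) b j =
      if (b : ℕ) < k + 1 then C (cnv R (fun c => s (b + c)) j)
      else cnv (fun i => C (R i)) v j := by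
    intro b j
    rw [Matrix.mul_apply]
    split_ifs with hb
    · have h3 := toep_sum (fun i => C (R i)) (fun c => C (s (b + c))) (k + 2) j j.2
      have h4 : C (cnv R (fun c => s (b + c)) j) =
        ∑ c ∈ Finset.range ((j : ℕ) + 1), C (R (j - c)) * C (s (b + c)) := by
        simp [cnv]
      rw [h4, ← h3]
      apply Finset.sum_congr rfl
      intro c _
      simp only [bordM, hb, hT, mul_comm, Matrix.of_apply, Matrix.transpose_apply, if_true, if_false]
    · rw [show cnv (fun i => C (R i)) v j = _ from
        (toep_sum (fun i => C (R i)) v (k + 2) j j.2).symm]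
      apply Finset.sum_congr rfl
      intro c _
      simp only [bordM, hb, hT, mul_comm, Matrix.of_apply, Matrix.transpose_apply, if_true, if_false]
  have key : ∀ i j : Fin (k + 2), (T' * (bordM s (k + 1) v * T.transpose)) i j =
      if (i : ℕ) < k + 1 then C (s 0 * hankW sh i j) else cnv (fun i => C (R i)) v j := by
    intro i j
    rw [Matrix.mul_apply]
    split_ifs with hi
    · rw [← hankV_eq a s sh h0 i j]
      have h3 := toep_sum (fun i => C (R i)) (fun b => C (cnv R (fun c => s (b + c)) j))
        (k + 2) i i.2
      have h4 : C (hankV R s i j) =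
        ∑ b ∈ Finset.range ((i : ℕ) + 1), C (R (i - b)) * C (cnv R (fun c => s (b + c)) j) := by
        simp only [hankV]
        rw [cnv]
        simp only [map_sum, map_mul]
      rw [h4, ← h3]
      apply Finset.sum_congr rfl
      intro b _
      rw [hMT]
      simp only [hT', Matrix.of_apply, hi, if_true]
      split_ifs with hb
      · rfl
      · have : ¬ ((b : ℕ) ≤ i) := by omega
        simp [toep, this]
    · have : ∀ b, T' i b = if b = i then 1 else 0 := by
        intro b
        simp only [hT', hi, Matrix.of_apply, if_false]
      simp only [this, ite_mul, one_mul, zero_mul, Finset.sum_ite_eq', Finset.mem_univ, if_true]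
      rw [hMT, if_neg hi]
  have hd : (T' * (bordM s (k + 1) v * T.transpose)).det = (bordM s (k + 1) v).det := by
    rw [Matrix.det_mul, Matrix.det_mul, Matrix.det_transpose, hdT, hdT', one_mul, mul_one]
  rw [← hd, Matrix.det_succ_row_zero, Fin.sum_univ_succ, Finset.sum_eq_zero, add_zero]
  · have hsub : (T' * (bordM s (k + 1) v * T.transpose)).submatrix Fin.succ
        (Fin.succAbove 0) = C (s 0) • bordM sh k q := by
      ext1 i j
      rw [Matrix.submatrix_apply, key]
      simp only [Fin.succAbove_zero, Fin.val_succ, hv, Matrix.smul_apply, smul_eq_mul, bordM,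
        Matrix.of_apply, hankW, add_lt_add_iff_right, C_mul]
      split_ifs <;> rfl
    rw [hsub, Matrix.det_smul, key]
    simp [hankW]
    ring
  · intro j _
    rw [key]
    simp [hankW]

/-- The polynomial `Q_m = Σ_{r<m} s_r X^{m-1-r}`. -/
def qPoly (s : ℕ → ℝ) (m : ℕ) : ℝ[X] :=
  ∑ r ∈ Finset.range m, C (s r) * X ^ (m - 1 - r)

theorem qPoly_succ (s : ℕ → ℝ) (m : ℕ) : qPoly s (m + 1) = X * qPoly s m + C (s m) := by
  unfold qPoly
  rw [Finset.sum_range_succ, Finset.mul_sum]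
  congr 1
  · apply Finset.sum_congr rfl
    intro r hr
    simp only [Finset.mem_range] at hr
    rw [show m + 1 - 1 - r = (m - 1 - r) + 1 by omega, pow_succ]
    ring
  · simp

theorem vrow (a : ℝ) (s sh : ℕ → ℝ)
    (h0 : ∀ m, cnv (schurR a sh) s m = if m = 0 then s 0 else 0) (j : ℕ) :
    cnv (fun i => C (schurR a sh i))
      (fun m => -C (s 0) * X ^ m + (X - C a) * qPoly s m) (j + 1) = C (s 0) * qPoly sh j := by
  have hs : ∀ j, cnv (fun i => C (schurR a sh i)) (fun b => C (s b)) j =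
      C (if j = 0 then s 0 else 0) := by
    intro j
    rw [← h0]
    simp [cnv]
  have hrec : ∀ j, cnv (fun i => C (schurR a sh i))
      (fun m => -C (s 0) * X ^ m + (X - C a) * qPoly s m) (j + 1) =
      - C (s 0) * C (schurR a sh (j + 1)) + X * cnv (fun i => C (schurR a sh i))
      (fun m => -C (s 0) * X ^ m + (X - C a) * qPoly s m) j +
      (X - C a) * C (if j = 0 then s 0 else 0) := by
    intro j
    have hstep : (fun b => -C (s 0) * X ^ (b + 1) + (X - C a) * qPoly s (b + 1)) =
        fun b => X * (-C (s 0) * X ^ b + (X - C a) * qPoly s b) + (X - C a) * C (s b) := by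
      funext b
      rw [qPoly_succ]
      ring
    rw [cnv_succ, hstep, cnv_add, cnv_mul, cnv_mul, hs]
    simp [qPoly]
    ring
  induction j with
  | zero =>
    rw [hrec, cnv_zero]
    simp [qPoly, schurR]
    ring
  | succ j ih =>
    rw [hrec, ih, qPoly_succ]
    simp [schurR]
    ring

/-- the map `X^m ↦ Q_m`. -/
def phiMap (s : ℕ → ℝ) : ℝ[X] →ₗ[ℝ] ℝ[X] :=
  Polynomial.lsum fun m => (LinearMap.toSpanSingleton ℝ ℝ[X] (qPoly s m))

theorem dPoly_eq_phi (s : ℕ → ℝ) (k : ℕ) : dPoly s k = phiMap s (ePoly s k) := by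
  rw [phiMap, Polynomial.lsum_apply, Polynomial.sum_over_range _ (by simp)]
  simp [dPoly, qPoly, Polynomial.smul_eq_C_mul]

theorem phi_CX (s : ℕ → ℝ) (c : ℝ) (m : ℕ) : phiMap s (C c * X ^ m) = C c * qPoly s m := by
  rw [phiMap, Polynomial.lsum_apply, Polynomial.C_mul_X_pow_eq_monomial, Polynomial.sum_monomial_index _ _ (by simp)]
  simp [Polynomial.smul_eq_C_mul]

theorem ePoly_succ_eq (s : ℕ → ℝ) (k : ℕ) :
    ePoly s (k + 1) = C (1 / Real.sqrt (hankelDet s k * hankelDet s (k + 1))) *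
      (bordM s (k + 1) (fun m => X ^ m)).det := rfl

theorem dPoly_succ_eq (s : ℕ → ℝ) (k : ℕ) :
    dPoly s (k + 1) = C (1 / Real.sqrt (hankelDet s k * hankelDet s (k + 1))) *
      (bordM s (k + 1) (qPoly s)).det := by
  rw [dPoly_eq_phi, ePoly_succ_eq, bordM_det, bordM_det, ← Polynomial.smul_eq_C_mul,
    map_smul, Polynomial.smul_eq_C_mul, map_sum]
  simp only [phi_CX]

theorem dPoly_zero_eq (s : ℕ → ℝ) : dPoly s 0 = 0 := by
  simp [dPoly, ePoly]

theorem main_alg (a : ℝ) (s sh : ℕ → ℝ) (hs0 : 0 < s 0)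
    (h0 : ∀ m, cnv (schurR a sh) s m = if m = 0 then s 0 else 0) (k : ℕ) :
    dPoly sh k = -C (Real.sqrt (s 0)) * ePoly s (k + 1) +
      C (1 / Real.sqrt (s 0)) * (X - C a) * dPoly s (k + 1) := by
  have hsq : 0 < Real.sqrt (s 0) := Real.sqrt_pos.2 hs0
  have hss : Real.sqrt (s 0) * Real.sqrt (s 0) = s 0 := Real.mul_self_sqrt hs0.le
  have hb := bord_schur a s sh h0 k _ (qPoly sh) (vrow a s sh h0)
  have hlin : (bordM s (k + 1)
      (fun m => -C (s 0) * X ^ m + (X - C a) * qPoly s m)).det =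
      -C (s 0) * (bordM s (k + 1) (fun m => X ^ m)).det
        + (X - C a) * (bordM s (k + 1) (qPoly s)).det := by
    simp only [bordM_det, Finset.mul_sum, ← Finset.sum_add_distrib]
    apply Finset.sum_congr rfl
    intro j _
    ring
  have hR : -C (Real.sqrt (s 0)) * ePoly s (k + 1) +
      C (1 / Real.sqrt (s 0)) * (X - C a) * dPoly s (k + 1) =
      C (1 / Real.sqrt (s 0) * (1 / Real.sqrt (hankelDet s k * hankelDet s (k + 1)))
        * s 0 ^ (k + 2)) * (bordM sh k (qPoly sh)).det := by
    rw [C_mul, mul_assoc (C _) (C (s 0 ^ (k + 2))), ← hb, hlin, ePoly_succ_eq, dPoly_succ_eq, C_mul]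
    have : C (Real.sqrt (s 0)) = C (1 / Real.sqrt (s 0)) * C (s 0) := by
      rw [← C_mul]
      congr 1
      field_simp
      rw [sq, hss]
    rw [this]
    ring
  rw [hR]
  cases k with
  | zero =>
    rw [dPoly_zero_eq, bordM_det]
    simp [qPoly]
  | succ k =>
    rw [dPoly_succ_eq]
    congr 2
    rw [hankel_schur a s sh h0 k, hankel_schur a s sh h0 (k + 1)]
    have : s 0 ^ (k + 2) * hankelDet sh k * (s 0 ^ (k + 1 + 2) * hankelDet sh (k + 1)) =
      (s 0 ^ (k + 2)) ^ 2 * (s 0 * (hankelDet sh k * hankelDet sh (k + 1))) := by ring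
    rw [this, Real.sqrt_mul (by positivity : 0 ≤ (s 0 ^ (k + 2)) ^ 2),
      Real.sqrt_sq (by positivity),
      Real.sqrt_mul hs0.le]
    set t := Real.sqrt (hankelDet sh k * hankelDet sh (k + 1))
    have h5 : s 0 ^ (k + 2) ≠ 0 := by positivity
    rw [one_div, one_div, one_div, mul_inv, mul_inv]
    have : (Real.sqrt (s 0))⁻¹ * ((s 0 ^ (k + 2))⁻¹ * ((Real.sqrt (s 0))⁻¹ * t⁻¹)) *
        s 0 ^ (k + 1 + 2) = ((Real.sqrt (s 0) * Real.sqrt (s 0))⁻¹ * s 0) *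
          ((s 0 ^ (k + 2))⁻¹ * s 0 ^ (k + 2)) * t⁻¹ := by
      rw [mul_inv]; ring
    rw [this, hss, inv_mul_cancel₀ hs0.ne', inv_mul_cancel₀ h5]
    ring

theorem hankelDet_congr (s s' : ℕ → ℝ) (k : ℕ) (h : ∀ j ≤ 2 * k, s j = s' j) :
    hankelDet s k = hankelDet s' k := by
  unfold hankelDet
  congr 2
  funext i j
  exact h _ (by omega)

theorem ePoly_congr (s s' : ℕ → ℝ) (k : ℕ) (h : ∀ j ≤ 2 * k, s j = s' j) :
    ePoly s k = ePoly s' k := by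
  cases k with
  | zero => simp [ePoly, h 0 (by omega)]
  | succ k =>
    rw [ePoly_succ_eq, ePoly_succ_eq, hankelDet_congr s s' (k + 1) h,
      hankelDet_congr s s' k (fun j hj => h j (by omega))]
    congr 2
    funext i j
    simp only [bordM, Matrix.of_apply]
    split_ifs
    · rw [h _ (by omega)]
    · rfl

theorem dPoly_congr (s s' : ℕ → ℝ) (k : ℕ) (h : ∀ j ≤ 2 * (k + 1), s j = s' j) :
    dPoly s (k + 1) = dPoly s' (k + 1) := by
  rw [dPoly_succ_eq, dPoly_succ_eq, hankelDet_congr s s' (k + 1) h,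
      hankelDet_congr s s' k (fun j hj => h j (by omega))]
  congr 2
  funext i j
  simp only [bordM, Matrix.of_apply]
  split_ifs
  · rw [h _ (by omega)]
  · unfold qPoly
    apply Finset.sum_congr rfl
    intro r hr
    simp only [Finset.mem_range] at hr
    rw [h _ (by omega)]

/-- Extension of the sequence so that the convolution relation holds to all orders. -/
theorem exists_ext (a : ℝ) (s sh : ℕ → ℝ) (N : ℕ)
    (h : ∀ m ≤ N, cnv (schurR a sh) s m = if m = 0 then s 0 else 0) :
    ∃ s' : ℕ → ℝ, (∀ j ≤ N, s j = s' j) ∧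
      ∀ m, cnv (schurR a sh) s' m = if m = 0 then s' 0 else 0 := by
  set P : PowerSeries ℝ := PowerSeries.mk (schurR a sh) with hP
  have hP0 : PowerSeries.constantCoeff P ≠ 0 := by
    rw [← PowerSeries.coeff_zero_eq_constantCoeff_apply]
    simp [hP, schurR]
  set Q := PowerSeries.C (s 0) * P⁻¹ with hQ
  have hPQ : Q * P = PowerSeries.C (s 0) := by
    rw [hQ, mul_assoc, PowerSeries.inv_mul_cancel _ hP0, mul_one]
  have hc : ∀ m, cnv (schurR a sh) (fun j => PowerSeries.coeff j Q) m =
      if m = 0 then s 0 else 0 := by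
    intro m
    have h1 := congrArg (PowerSeries.coeff m) hPQ
    rw [PowerSeries.coeff_mul, PowerSeries.coeff_C,
      Finset.Nat.sum_antidiagonal_eq_sum_range_succ_mk] at h1
    rw [← h1, cnv]
    apply Finset.sum_congr rfl
    intro b _
    simp [hP, mul_comm]
  have hz : PowerSeries.coeff 0 Q = s 0 := by
    have := hc 0
    rw [cnv_zero] at this
    simpa [schurR] using this
  refine ⟨fun j => PowerSeries.coeff j Q, ?_, ?_⟩
  · intro j
    induction j using Nat.strong_induction_on with
    | _ j ih =>
      intro hj
      have h1 := h j hj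
      rw [← hc j, cnv, cnv, Finset.sum_range_succ, Finset.sum_range_succ] at h1
      have h2 : ∑ b ∈ Finset.range j, schurR a sh (j - b) * s b =
          ∑ b ∈ Finset.range j, schurR a sh (j - b) * PowerSeries.coeff b Q := by
        apply Finset.sum_congr rfl
        intro b hb
        simp only [Finset.mem_range] at hb
        rw [ih b hb (by omega)]
      rw [h2] at h1
      simpa [schurR] using h1
  · intro m
    rw [hc]
    simp only [hz]

theorem poly_small (P : ℂ[X]) (N : ℕ) (w : ℝ → ℂ) (g : ℝ → ℂ)
    (hw : Tendsto w atTop (nhds 0)) (hw0 : ∀ᶠ y in atTop, w y ≠ 0)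
    (hg : Tendsto g atTop (nhds 0)) (hP : ∀ᶠ y in atTop, P.eval (w y) = w y ^ N * g y) :
    ∀ m ≤ N, P.coeff m = 0 := by
  intro m
  induction m using Nat.strong_induction_on with
  | _ m ih =>
    intro hm
    have hd : X ^ m ∣ P := Polynomial.X_pow_dvd_iff.2 fun d hd => ih d hd (by omega)
    obtain ⟨Q, rfl⟩ := hd
    have hcoef : (X ^ m * Q).coeff m = Q.eval 0 := by
      rw [← Polynomial.coeff_zero_eq_eval_zero]
      simpa using Polynomial.coeff_X_pow_mul Q m 0
    rw [hcoef]
    have h1 : Tendsto (fun y => Q.eval (w y)) atTop (nhds (Q.eval 0)) :=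
      (Q.continuous.tendsto 0).comp hw
    have h2 : Tendsto (fun y => w y ^ (N - m) * g y) atTop (nhds (0 ^ (N - m) * 0)) :=
      (hw.pow _).mul hg
    rw [mul_zero] at h2
    have h3 : (fun y => w y ^ (N - m) * g y) =ᶠ[atTop] fun y => Q.eval (w y) := by
      filter_upwards [hw0, hP] with y hy hPy
      rw [eval_mul, eval_pow, eval_X] at hPy
      have : w y ^ N = w y ^ m * w y ^ (N - m) := by rw [← pow_add]; congr 1; omega
      rw [this, mul_assoc] at hPy
      exact (mul_left_cancel₀ (pow_ne_zero m hy) hPy).symm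
    exact tendsto_nhds_unique h1 (h2.congr' h3)

theorem sum_tendsto (s : ℕ → ℝ) (N : ℕ) (w : ℝ → ℂ) (hw : Tendsto w atTop (nhds 0)) :
    Tendsto (fun y => ∑ j ∈ Finset.range (N + 1), (s j : ℂ) * w y ^ j) atTop
      (nhds (s 0 : ℂ)) := by
  have : Tendsto (fun y => ∑ j ∈ Finset.range (N + 1), (s j : ℂ) * w y ^ j) atTop
      (nhds (∑ j ∈ Finset.range (N + 1), (s j : ℂ) * 0 ^ j)) :=
    tendsto_finsetSum _ fun j _ => tendsto_const_nhds.mul (hw.pow j)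
  rw [Finset.sum_range_succ'] at this
  simpa using this

/-- Multiplicative form of the expansion. -/
theorem cond_form (n : ℂ → ℂ) (q : ℕ) (s : ℕ → ℝ) (h : Cond1 n q s) :
    ∃ f : ℝ → ℂ, Tendsto f atTop (nhds 0) ∧ ∀ᶠ y : ℝ in atTop,
      (I * y) * n (I * y) = -∑ j ∈ Finset.range (2 * q + 1), (s j : ℂ) * ((I * y)⁻¹) ^ j
        + ((I * y)⁻¹) ^ (2 * q) * f y := by
  refine ⟨_, h.mono_left le_sup_left, ?_⟩
  filter_upwards [eventually_gt_atTop 0] with y hy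
  have hz : (I * y : ℂ) ≠ 0 := by simp [hy.ne']
  set z : ℂ := I * y
  have h1 : ∑ j ∈ Finset.range (2 * q + 1), (s j : ℂ) * z⁻¹ ^ j =
      z * ∑ j ∈ Finset.range (2 * q + 1), (s j : ℂ) / z ^ (j + 1) := by
    rw [Finset.mul_sum]
    apply Finset.sum_congr rfl
    intro j _
    rw [inv_pow, pow_succ]
    field_simp
  rw [h1, inv_pow, pow_succ]
  field_simp
  ring

theorem w_tendsto : Tendsto (fun y : ℝ => (I * (y : ℂ))⁻¹) atTop (nhds 0) := by
  rw [tendsto_zero_iff_norm_tendsto_zero]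
  have : (fun y : ℝ => ‖(I * (y : ℂ))⁻¹‖) = fun y : ℝ => |y|⁻¹ := by
    funext y
    simp
  rw [this]
  exact tendsto_inv_atTop_zero.comp tendsto_abs_atTop_atTop

theorem rel_of_cond (q : ℕ) (n : ℂ → ℂ) (hn : IsNevanlinna n) (s sh : ℕ → ℝ)
    (h1 : Cond1 n (q + 1) s)
    (h2 : Cond1 (fun z : ℂ => -(s 0 : ℂ) / n z - z + (s 1 : ℂ) / (s 0 : ℂ)) q sh) :
    0 < s 0 ∧ ∀ m ≤ 2 * (q + 1),
      cnv (schurR (s 1 / s 0) sh) s m = if m = 0 then s 0 else 0 := by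
  obtain ⟨f, hf, hfe⟩ := cond_form _ _ _ h1
  obtain ⟨g, hg, hge⟩ := cond_form _ _ _ h2
  have hw := w_tendsto
  have hA := sum_tendsto s (2 * (q + 1)) _ hw
  have hB := sum_tendsto sh (2 * q) _ hw
  set A := fun y : ℝ => ∑ j ∈ Finset.range (2 * (q + 1) + 1), (s j : ℂ) * ((I * (y : ℂ))⁻¹) ^ j
  set B := fun y : ℝ => ∑ j ∈ Finset.range (2 * q + 1), (sh j : ℂ) * ((I * (y : ℂ))⁻¹) ^ j
  have hzn : Tendsto (fun y : ℝ => (I * (y : ℂ)) * n (I * y)) atTop (nhds (-(s 0 : ℂ))) := by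
    have h3 := hA.neg.add ((hw.pow (2 * (q + 1))).mul hf)
    rw [mul_zero, add_zero] at h3
    refine h3.congr' ?_
    filter_upwards [hfe] with y hy
    exact hy.symm
  have hs0 : s 0 ≠ 0 := by
    intro hs
    have h3 : Tendsto (fun y : ℝ => (I * (y : ℂ))⁻¹ ^ 2 * (-B y + (I * (y : ℂ))⁻¹ ^ (2 * q) * g y))
        atTop (nhds (0 ^ 2 * (-(sh 0 : ℂ) + 0 ^ (2 * q) * 0))) :=
      (hw.pow 2).mul (hB.neg.add ((hw.pow _).mul hg))
    have h4 : Tendsto (fun y : ℝ => (I * (y : ℂ))⁻¹ ^ 2 *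
        (-B y + (I * (y : ℂ))⁻¹ ^ (2 * q) * g y)) atTop (nhds (-1)) := by
      refine tendsto_const_nhds.congr' ?_
      filter_upwards [hge, eventually_gt_atTop 0] with y hy hy0
      have hz : (I * y : ℂ) ≠ 0 := by simp [hy0.ne']
      rw [← hy, hs]
      set z : ℂ := I * y
      simp
      field_simp
    have h5 := tendsto_nhds_unique h3 h4
    norm_num at h5
  have hs0' : 0 ≤ s 0 := by
    have h3 : Tendsto (fun y : ℝ => ((I * (y : ℂ)) * n (I * y)).re) atTop
        (nhds (-(s 0 : ℂ)).re) := (Complex.continuous_re.tendsto _).comp hzn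
    have h4 : (-(s 0 : ℂ)).re ≤ 0 := by
      refine le_of_tendsto h3 ?_
      filter_upwards [eventually_gt_atTop 0] with y hy
      have h6 := hn.2.2 (I * y) (by simpa using hy)
      have : 0 ≤ y * (n (I * y)).im := mul_nonneg hy.le h6
      simpa [Complex.mul_re] using this
    simpa using h4
  refine ⟨lt_of_le_of_ne hs0' hs0.symm, ?_⟩
  set a := s 1 / s 0 with ha
  set R := schurR a sh with hR
  set PA : ℂ[X] := ∑ j ∈ Finset.range (2 * (q + 1) + 1), C (s j : ℂ) * X ^ j with hPA
  set PR : ℂ[X] := ∑ j ∈ Finset.range (2 * (q + 1) + 1), C (R j : ℂ) * X ^ j with hPR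
  have hsc : (s 0 : ℂ) ≠ 0 := by exact_mod_cast hs0
  have hn0 : ∀ᶠ y : ℝ in atTop, (I * (y : ℂ)) * n (I * y) ≠ 0 :=
    hzn.eventually_ne (neg_ne_zero.2 hsc)
  have hevA : ∀ y : ℝ, PA.eval ((I * (y : ℂ))⁻¹) = A y := by
    intro y
    simp [hPA, A, Polynomial.eval_finsetSum]
  have hevR : ∀ y : ℝ, PR.eval ((I * (y : ℂ))⁻¹) =
      1 - a * (I * (y : ℂ))⁻¹ - ((I * (y : ℂ))⁻¹) ^ 2 * B y := by
    intro y
    rw [hPR, Polynomial.eval_finsetSum, show 2 * (q + 1) + 1 = (2 * q + 1) + 1 + 1 by ring,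
      Finset.sum_range_succ', Finset.sum_range_succ']
    simp only [B, Finset.mul_sum, hR, schurR, eval_mul, eval_C, eval_pow, eval_X]
    have : ∀ j ∈ Finset.range (2 * q + 1), ((-sh j : ℝ) : ℂ) * (I * (y : ℂ))⁻¹ ^ (j + 1 + 1) =
        -((I * (y : ℂ))⁻¹ ^ 2 * ((sh j : ℂ) * (I * (y : ℂ))⁻¹ ^ j)) := by
      intro j _
      push_cast
      ring
    rw [Finset.sum_congr rfl this, Finset.sum_neg_distrib]
    push_cast
    ring
  have hCt : Tendsto (fun y : ℝ => PR.eval ((I * (y : ℂ))⁻¹)) atTop (nhds (PR.eval 0)) :=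
    (PR.continuous.tendsto 0).comp hw
  have hG : Tendsto (fun y : ℝ => f y * PR.eval ((I * (y : ℂ))⁻¹) - A y * g y
      + (I * (y : ℂ))⁻¹ ^ (2 * (q + 1)) * f y * g y) atTop (nhds 0) := by
    have h3 := ((hf.mul hCt).sub (hA.mul hg)).add (((hw.pow (2 * (q + 1))).mul hf).mul hg)
    simpa using h3
  have hcoef := poly_small (PA * PR - C (s 0 : ℂ)) (2 * (q + 1)) _ _ hw
    (by
      filter_upwards [eventually_gt_atTop 0] with y hy
      simp [hy.ne']) hG
    (by
      filter_upwards [hfe, hge, hn0, eventually_gt_atTop 0] with y hy1 hy2 hy3 hy0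
      have hz : (I * y : ℂ) ≠ 0 := by simp [hy0.ne']
      rw [eval_sub, eval_mul, eval_C, hevA, hevR]
      change _ = -A y + _ at hy1
      change _ = -B y + _ at hy2
      have haC : (a : ℂ) = (s 1 : ℂ) / (s 0 : ℂ) := by rw [ha]; push_cast; rfl
      rw [← haC] at hy2
      generalize A y = A' at *
      generalize B y = B' at *
      generalize f y = f' at *
      generalize g y = g' at *
      generalize (I * y : ℂ) = z at *
      have hnz : n z ≠ 0 := right_ne_zero_of_mul hy3
      have e1 : A' = z⁻¹ ^ (2 * (q + 1)) * f' - z * n z := by rw [hy1]; ring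
      have e2 : B' = z⁻¹ ^ (2 * q) * g' - z * (-(s 0 : ℂ) / n z - z + a) := by rw [hy2]; ring
      have e3 : (z * n z) * (z⁻¹ ^ 2 * (z * (-(s 0 : ℂ) / n z))) = -(s 0 : ℂ) := by
        field_simp
      have e4 : z⁻¹ * z = 1 := inv_mul_cancel₀ hz
      have e5 : 1 - a * z⁻¹ - z⁻¹ ^ 2 * B' =
          z⁻¹ ^ 2 * (z * (-(s 0 : ℂ) / n z)) - z⁻¹ ^ (2 * (q + 1)) * g' := by
        rw [e2, show 2 * (q + 1) = 2 * q + 2 by ring, pow_add]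
        linear_combination (-(z⁻¹ * z) - 1 + z⁻¹ * a) * e4
      rw [e5]
      rw [e1]
      linear_combination -e3)
  intro m hm
  have h3 := hcoef m hm
  rw [coeff_sub, coeff_C, coeff_mul, Finset.Nat.sum_antidiagonal_eq_sum_range_succ_mk] at h3
  have hcA : ∀ b ≤ 2 * (q + 1), PA.coeff b = (s b : ℂ) := by
    intro b hb
    simp only [hPA, finsetSum_coeff, coeff_C_mul, coeff_X_pow]
    simp
    intro h; omega
  have hcR : ∀ b ≤ 2 * (q + 1), PR.coeff b = (R b : ℂ) := by
    intro b hb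
    simp only [hPR, finsetSum_coeff, coeff_C_mul, coeff_X_pow]
    simp
    intro h; omega
  have h4 : ((cnv R s m : ℝ) : ℂ) = ((if m = 0 then s 0 else 0 : ℝ) : ℂ) := by
    rw [sub_eq_zero] at h3
    rw [cnv]
    rw [show ((if m = 0 then s 0 else 0 : ℝ) : ℂ) = if m = 0 then (s 0 : ℂ) else 0 by
      split_ifs <;> simp, ← h3]
    push_cast
    apply Finset.sum_congr rfl
    intro b hb
    simp only [Finset.mem_range] at hb
    rw [hcA b (by omega), hcR _ (by omega), mul_comm]
  exact_mod_cast h4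

/-- if `n` is Nevanlinna with `(1_p)`, `D_p > 0`, and `sh` are the coefficients
of the expansion `(1_{p-1})` of the Schur transform `n̂`, then the polynomials of the second
kind `d̂_k` of `sh` satisfy `d̂_k(z) = -√s₀·e_{k+1}(z) + (1/√s₀)·(z - s₁/s₀)·d_{k+1}(z)`
for `k = 0,…,p-1`. -/
theorem second_kind_polys_of_schur_transform (p : ℕ) (hp : 2 ≤ p) (n : ℂ → ℂ)
    (hn : IsNevanlinna n) (s : ℕ → ℝ) (h1p : Cond1 n p s)
    (hDp : 0 < hankelDet s p)
    (sh : ℕ → ℝ)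
    (hsh : Cond1 (fun z : ℂ => -(s 0 : ℂ) / n z - z + (s 1 : ℂ) / (s 0 : ℂ)) (p - 1) sh) :
    ∀ k ≤ p - 1, ∀ z : ℂ,
      Polynomial.aeval z (dPoly sh k) =
        -(Real.sqrt (s 0) : ℂ) * Polynomial.aeval z (ePoly s (k + 1)) +
          (1 / (Real.sqrt (s 0) : ℂ)) * (z - (s 1 : ℂ) / (s 0 : ℂ)) *
            Polynomial.aeval z (dPoly s (k + 1)) := by
  obtain ⟨q, rfl⟩ : ∃ q, p = q + 1 := ⟨p - 1, by omega⟩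
  rw [Nat.add_sub_cancel] at hsh
  obtain ⟨hs0, hrel⟩ := rel_of_cond q n hn s sh h1p hsh
  obtain ⟨s', hss', hrel'⟩ := exists_ext _ s sh _ hrel
  intro k hk z
  rw [Nat.add_sub_cancel] at hk
  have h00 : s 0 = s' 0 := hss' 0 (by omega)
  have hmain := main_alg _ s' sh (h00 ▸ hs0) hrel' k
  rw [← ePoly_congr s s' (k + 1) (fun j hj => hss' j (by omega)),
    ← dPoly_congr s s' k (fun j hj => hss' j (by omega)), ← h00] at hmain
  rw [hmain]
  simp
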